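/- Let q_k = P(S_m = m − 2k), r_k = ((m−k)p + k(1−p))/m and p_k = (m−2k)(2p−1)/m for 0 ≤ k ≤ m. Then, as n → ∞, S_n/n converges in distribution to the discrete law Σ_{k=0}^m q_k·δ_{p_k} (point mass q_k at p_k), and (S_n − n(2p−1)S_m/m)/√n converges in distribution to the mixture of normal laws Σ_{k=0}^m q_k·N(0, 4 r_k(1−r_k)). -/

import Mathlib

open MeasureTheory ProbabilityTheory Filter Topology

noncomputable section

/-- The σ-algebra generated by the steps `X 1, …, X n`. -/
def sigmaUpTo {Ω : Type*} (X : ℕ → Ω → ℝ) (n : ℕ) : MeasurableSpace Ω :=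
  ⨆ i ∈ Finset.Icc 1 n, MeasurableSpace.comap (X i) inferInstance

/-- The σ-algebra generated by all the steps `X 1, X 2, …`. -/
def sigmaAll {Ω : Type*} (X : ℕ → Ω → ℝ) : MeasurableSpace Ω :=
  ⨆ i ∈ Set.Ici 1, MeasurableSpace.comap (X i) inferInstance

/-- The partial sum `X 1 + ⋯ + X n` of the walk. -/
def partialSum {Ω : Type*} (X : ℕ → Ω → ℝ) (n : ℕ) (ω : Ω) : ℝ :=
  ∑ k ∈ Finset.Icc 1 n, X k ω

/-- Convergence in distribution of the random variables `f n` to the law `ν`,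
expressed as weak convergence tested against bounded continuous functions. -/
def TendstoInDistribution {Ω : Type*} [MeasurableSpace Ω] (μ : Measure Ω)
    (f : ℕ → Ω → ℝ) (ν : Measure ℝ) : Prop :=
  ∀ g : BoundedContinuousFunction ℝ ℝ,
    Tendsto (fun n => ∫ ω, g (f n ω) ∂μ) atTop (𝓝 (∫ x, g x ∂ν))

open Complex in
lemma exp_mul_ofReal_sub_sum_isLittleO (b : ℂ) (j : ℕ) :
    (fun s : ℝ => exp (b * s) - ∑ i ∈ Finset.range (j + 1), (b * s) ^ i / (i.factorial : ℂ))
      =o[𝓝 0] fun s : ℝ => (s : ℂ) ^ j := by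
  have h0 : Tendsto (fun s : ℝ => b * (s : ℂ)) (𝓝 0) (𝓝 0) := by
    have : Continuous fun s : ℝ => b * (s : ℂ) := by fun_prop
    simpa using this.tendsto 0
  refine ((exp_sub_sum_range_succ_isLittleO_pow j).comp_tendsto h0).trans_isBigO ?_
  simp only [Function.comp_def, mul_pow]
  exact Asymptotics.isBigO_const_mul_self _ _ _

open Complex in
lemma tendsto_pow_exp_of_isLittleO {f : ℝ → ℂ} {κ : ℂ} {j : ℕ} {s : ℕ → ℝ} {v : ℝ}
    (hf : (fun x => f x - (1 + κ * x ^ j)) =o[𝓝 0] fun x : ℝ => (x : ℂ) ^ j)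
    (hs : Tendsto s atTop (𝓝 0)) (hv : Tendsto (fun N : ℕ => (N : ℝ) * s N ^ j) atTop (𝓝 v)) :
    Tendsto (fun N => f (s N) ^ N) atTop (𝓝 (exp (κ * v))) := by
  have hvc : Tendsto (fun N : ℕ => (N : ℂ) * (s N : ℂ) ^ j) atTop (𝓝 (v : ℂ)) := by
    simpa [Function.comp_def] using (continuous_ofReal.tendsto v).comp hv
  have hrem : Tendsto (fun N : ℕ => (N : ℂ) * (f (s N) - (1 + κ * (s N : ℂ) ^ j))) atTop (𝓝 0) := by
    rw [← Asymptotics.isLittleO_one_iff ℂ]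
    exact ((Asymptotics.isBigO_refl (fun N : ℕ => (N : ℂ)) atTop).mul_isLittleO
      (hf.comp_tendsto hs)).trans_isBigO (hvc.isBigO_one ℂ)
  have := tendsto_one_add_pow_exp_of_tendsto (g := fun N => f (s N) - 1) (t := κ * v) (by
    refine ((hvc.const_mul κ).add hrem).congr' (.of_forall fun N => ?_) |>.trans (by simp)
    ring)
  simpa using this

open Complex in
lemma cos_add_sin_sub_isLittleO (a : ℂ) :
    (fun s : ℝ => (cos s + a * sin s * I) - (1 + a * I * s ^ 1)) =o[𝓝 0]
      fun s : ℝ => (s : ℂ) ^ 1 := by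
  refine (((exp_mul_ofReal_sub_sum_isLittleO I 1).const_mul_left ((1 + a) / 2)).add
    ((exp_mul_ofReal_sub_sum_isLittleO (-I) 1).const_mul_left ((1 - a) / 2))).congr_left fun s => ?_
  rw [show I * (s : ℂ) = s * I by ring, show -I * (s : ℂ) = (-s : ℂ) * I by ring,
    exp_mul_I, exp_mul_I, cos_neg, sin_neg]
  simp [Finset.sum_range_succ]
  ring

open Complex in
lemma exp_neg_mul_cos_add_sin_sub_isLittleO (a : ℂ) :
    (fun s : ℝ => exp (-(a * s * I)) * (cos s + a * sin s * I)
        - (1 + (-(1 - a ^ 2) / 2) * s ^ 2)) =o[𝓝 0] fun s : ℝ => (s : ℂ) ^ 2 := by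
  refine (((exp_mul_ofReal_sub_sum_isLittleO (I * (1 - a)) 2).const_mul_left ((1 + a) / 2)).add
    ((exp_mul_ofReal_sub_sum_isLittleO (-I * (1 + a)) 2).const_mul_left
      ((1 - a) / 2))).congr_left fun s => ?_
  rw [show I * (1 - a) * (s : ℂ) = -(a * s * I) + s * I by ring,
    show -I * (1 + a) * (s : ℂ) = -(a * s * I) + (-s : ℂ) * I by ring,
    exp_add, exp_add, exp_mul_I, exp_mul_I, cos_neg, sin_neg]
  simp only [Finset.sum_range_succ, Finset.sum_range_zero, Nat.factorial]
  push_cast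
  linear_combination (-(1-a^2)/2 * (s:ℂ)^2) * I_sq

open Complex in
lemma integrable_exp_mul_I {Ω : Type*} [MeasurableSpace Ω] {f : Ω → ℝ}
    (hf : Measurable f) (ν : Measure Ω) [IsFiniteMeasure ν] :
    Integrable (fun ω => exp (f ω * I)) ν :=
  .of_bound (C := 1) (by fun_prop) (.of_forall fun ω => (norm_exp_ofReal_mul_I _).le)

lemma setIntegral_mul_eq_of_condExp_eq {Ω : Type*} {m m0 : MeasurableSpace Ω} {μ : Measure Ω}
    [IsFiniteMeasure μ] (hm : m ≤ m0)
    {A : Set Ω} (hA : MeasurableSet[m] A) {f : Ω → ℂ} (hf : StronglyMeasurable[m] f)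
    {Y : Ω → ℝ} (hY : Integrable Y μ) (hfY : Integrable (fun ω => Y ω • f ω) μ) {a : ℝ}
    (ha : ∀ᵐ ω ∂μ, ω ∈ A → (μ[Y | m]) ω = a) :
    ∫ ω in A, Y ω • f ω ∂μ = a * ∫ ω in A, f ω ∂μ := by
  have hpull : μ[Y • f | m] =ᵐ[μ] μ[Y | m] • f :=
    condExp_smul_of_aestronglyMeasurable_right hY hfY hf.aestronglyMeasurable
  rw [← integral_const_mul]
  refine (setIntegral_condExp (f := Y • f) hm hfY hA).symm.trans
    (setIntegral_congr_ae (hm _ hA) ?_)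
  filter_upwards [hpull, ha] with ω h1 h2 hω
  exact h1.trans (by simp [h2 hω])

lemma tendsto_div_natCast_add (c : ℝ) (m : ℕ) :
    Tendsto (fun N : ℕ => c / ((N + m : ℕ) : ℝ)) atTop (𝓝 0) :=
  (tendsto_add_atTop_iff_nat m).2 (tendsto_const_div_atTop_nhds_zero_nat c)

lemma tendsto_natCast_mul_div_natCast_add (c : ℝ) (m : ℕ) :
    Tendsto (fun N : ℕ => (N : ℝ) * (c / ((N : ℝ) + m))) atTop (𝓝 c) := by
  have := (tendsto_natCast_div_add_atTop (m : ℝ)).mul_const c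
  rw [one_mul] at this
  exact this.congr fun N => by ring

lemma tendsto_exp_mul_I_one {s : ℕ → ℝ} (hs : Tendsto s atTop (𝓝 0)) (c : ℝ) :
    Tendsto (fun N => Complex.exp ((s N * c : ℝ) * Complex.I)) atTop (𝓝 1) := by
  have h : Continuous fun x : ℝ => Complex.exp ((x * c : ℝ) * Complex.I) := by fun_prop
  have h0 := (h.tendsto 0).comp hs
  rwa [zero_mul, Complex.ofReal_zero, zero_mul, Complex.exp_zero] at h0

section
variable {Ω : Type*} {X : ℕ → Ω → ℝ}

lemma sigmaUpTo_mono {n k : ℕ} (h : n ≤ k) : sigmaUpTo X n ≤ sigmaUpTo X k :=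
  biSup_mono fun _ hi => Finset.Icc_subset_Icc_right h hi

lemma measurable_partialSum_sigmaUpTo (n : ℕ) : Measurable[sigmaUpTo X n] (partialSum X n) := by
  refine Finset.measurable_fun_sum _ fun i hi => ?_
  exact (comap_measurable (X i)).mono
    (le_iSup₂ (f := fun i (_ : i ∈ Finset.Icc 1 n) =>
      MeasurableSpace.comap (X i) inferInstance) i hi) le_rfl

lemma partialSum_succ (n : ℕ) (ω : Ω) :
    partialSum X (n + 1) ω = partialSum X n ω + X (n + 1) ω :=
  Finset.sum_Icc_succ_top (by omega) _

variable [MeasurableSpace Ω] {μ : Measure Ω}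

lemma sigmaUpTo_le (hX : ∀ i, Measurable (X i)) (n : ℕ) : sigmaUpTo X n ≤ ‹MeasurableSpace Ω› :=
  iSup₂_le fun i _ => (hX i).comap_le

lemma measurable_partialSum (hX : ∀ i, Measurable (X i)) (n : ℕ) : Measurable (partialSum X n) :=
  (measurable_partialSum_sigmaUpTo n).mono (sigmaUpTo_le hX n) le_rfl

lemma ae_exists_partialSum_eq (hval : ∀ i, 1 ≤ i → ∀ᵐ ω ∂μ, X i ω = 1 ∨ X i ω = -1) (n : ℕ) :
    ∀ᵐ ω ∂μ, ∃ k ∈ Finset.range (n + 1), partialSum X n ω = (n : ℝ) - 2 * k := by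
  induction n with
  | zero => exact .of_forall fun ω => ⟨0, by simp [partialSum]⟩
  | succ n ih =>
    filter_upwards [ih, hval (n + 1) (by omega)] with ω ⟨k, hk, hS⟩ hX
    rw [partialSum_succ, hS]
    rw [Finset.mem_range] at hk
    rcases hX with hX | hX
    · exact ⟨k, Finset.mem_range.2 (by omega), by rw [hX]; push_cast; ring⟩
    · exact ⟨k + 1, Finset.mem_range.2 (by omega), by rw [hX]; push_cast; ring⟩

variable [IsProbabilityMeasure μ]

open Complex in
lemma setIntegral_exp_partialSum_succ (hX : ∀ i, Measurable (X i)) {n : ℕ}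
    (hval : ∀ᵐ ω ∂μ, X (n + 1) ω = 1 ∨ X (n + 1) ω = -1)
    {A : Set Ω} (hA : MeasurableSet[sigmaUpTo X n] A) {a : ℝ}
    (ha : ∀ᵐ ω ∂μ, ω ∈ A → (μ[X (n + 1) | sigmaUpTo X n]) ω = a) (s : ℝ) :
    ∫ ω in A, exp ((s * partialSum X (n + 1) ω : ℝ) * I) ∂μ =
      (∫ ω in A, exp ((s * partialSum X n ω : ℝ) * I) ∂μ) * (cos s + a * sin s * I) := by
  have hSm := measurable_partialSum hX n
  have hXint : Integrable (X (n + 1)) μ :=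
    .of_bound (C := 1) (hX _).aestronglyMeasurable
      (by filter_upwards [hval] with ω h; rcases h with h | h <;> simp [h])
  have hE : Integrable (fun ω => exp ((s * partialSum X n ω : ℝ) * I)) μ :=
    integrable_exp_mul_I (by fun_prop) μ
  have hXE : Integrable (fun ω => X (n + 1) ω • exp ((s * partialSum X n ω : ℝ) * I)) μ := by
    refine .of_bound (C := 1) ((hX _).smul (by fun_prop)).aestronglyMeasurable ?_
    filter_upwards [hval] with ω h
    rw [norm_smul, norm_exp_ofReal_mul_I]
    rcases h with h | h <;> simp [h]
  have hEm : StronglyMeasurable[sigmaUpTo X n]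
      (fun ω => exp ((s * partialSum X n ω : ℝ) * I)) := by
    have h1 : Continuous fun x : ℝ => exp ((s * x : ℝ) * I) := by fun_prop
    exact h1.comp_stronglyMeasurable (measurable_partialSum_sigmaUpTo n).stronglyMeasurable
  have key := setIntegral_mul_eq_of_condExp_eq (sigmaUpTo_le hX n) hA hEm hXint hXE ha
  have hsplit : ∀ᵐ ω ∂μ, exp ((s * partialSum X (n + 1) ω : ℝ) * I) =
      cos s * exp ((s * partialSum X n ω : ℝ) * I) +
        (sin s * I) * (X (n + 1) ω • exp ((s * partialSum X n ω : ℝ) * I)) := by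
    filter_upwards [hval] with ω h
    rw [partialSum_succ, mul_add, ofReal_add, add_mul, exp_add]
    rcases h with h | h
    · rw [h, mul_one, exp_mul_I (s : ℂ), one_smul]
      ring
    · rw [h, mul_neg_one, ofReal_neg, exp_mul_I (-(s : ℂ)), cos_neg, sin_neg, neg_one_smul]
      ring
  rw [integral_congr_ae (ae_restrict_of_ae hsplit),
    integral_add (hE.integrableOn.const_mul _) (hXE.integrableOn.const_mul _),
    integral_const_mul, integral_const_mul, key]
  ring

open Complex in
lemma setIntegral_exp_partialSum (hX : ∀ i, Measurable (X i))
    (hval : ∀ i, 1 ≤ i → ∀ᵐ ω ∂μ, X i ω = 1 ∨ X i ω = -1) {m : ℕ} {x a : ℝ}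
    (ha : ∀ n, m ≤ n → ∀ᵐ ω ∂μ, partialSum X m ω = x →
      (μ[X (n + 1) | sigmaUpTo X n]) ω = a) (s : ℝ) (N : ℕ) :
    ∫ ω in {ω | partialSum X m ω = x}, exp ((s * partialSum X (N + m) ω : ℝ) * I) ∂μ =
      μ.real {ω | partialSum X m ω = x} * exp ((s * x : ℝ) * I) *
        (cos s + a * sin s * I) ^ N := by
  have hA : MeasurableSet[sigmaUpTo X m] {ω | partialSum X m ω = x} :=
    measurable_partialSum_sigmaUpTo m (measurableSet_singleton x)
  induction N with
  | zero =>
    rw [setIntegral_congr_fun (g := fun _ => exp ((s * x : ℝ) * I)) (sigmaUpTo_le hX m _ hA)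
      fun ω (hω : partialSum X m ω = x) => by simp [hω]]
    simp
  | succ N ih =>
    rw [show N + 1 + m = N + m + 1 by omega, setIntegral_exp_partialSum_succ hX (hval _ (by omega))
      (sigmaUpTo_mono (by omega) _ hA) (ha _ (by omega)), ih]
    ring

open Complex in
/-- Lévy's criterion for convergence to a finite mixture, along a finite almost sure partition. -/
lemma tendstoInDistribution_sum_smul {ι : Type*} {K : Finset ι} {A : ι → Set Ω}
    (hA : ∀ k, MeasurableSet (A k)) (hdisj : Set.Pairwise (K : Set ι) (Function.onFun Disjoint A))
    (hcover : ∀ᵐ ω ∂μ, ∃ k ∈ K, ω ∈ A k) {f : ℕ → Ω → ℝ} (hf : ∀ n, Measurable (f n))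
    {ν : ι → Measure ℝ} [∀ k, IsProbabilityMeasure (ν k)]
    (h : ∀ k ∈ K, ∀ t : ℝ, Tendsto (fun n => ∫ ω in A k, exp ((t * f n ω : ℝ) * I) ∂μ) atTop
      (𝓝 (μ.real (A k) * charFun (ν k) t))) :
    _root_.TendstoInDistribution μ f (∑ k ∈ K, μ (A k) • ν k) := by
  have huniv : (⋃ k ∈ K, A k : Set Ω) =ᵐ[μ] Set.univ := by
    refine eventuallyEq_univ.2 ?_
    filter_upwards [hcover] with ω hω
    simpa using hω
  have : IsProbabilityMeasure (∑ k ∈ K, μ (A k) • ν k) := ⟨by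
    simp only [Measure.coe_finsetSum, Finset.sum_apply, Measure.smul_apply, measure_univ,
      smul_eq_mul, mul_one]
    rw [← measure_biUnion_finset hdisj fun k _ => hA k, measure_congr huniv, measure_univ]⟩
  have : ∀ n, IsProbabilityMeasure (μ.map (f n)) := fun n =>
    Measure.isProbabilityMeasure_map (hf n).aemeasurable
  have hlim := (ProbabilityMeasure.tendsto_iff_tendsto_charFun
    (μ := fun n => ⟨μ.map (f n), inferInstance⟩)
    (μ₀ := ⟨∑ k ∈ K, μ (A k) • ν k, inferInstance⟩)).2 fun t => by
      have hν : charFun (∑ k ∈ K, μ (A k) • ν k) t = ∑ k ∈ K, μ.real (A k) * charFun (ν k) t := by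
        simp only [charFun_apply_real]
        rw [integral_finsetSum_measure]
        · simp [integral_smul_measure, Measure.real]
        · intro k _
          refine Integrable.smul_measure ?_ (measure_ne_top _ _)
          simpa using integrable_exp_mul_I (f := fun x : ℝ => t * x) (by fun_prop) (ν k)
      have hμ : ∀ n, charFun (μ.map (f n)) t =
          ∑ k ∈ K, ∫ ω in A k, exp ((t * f n ω : ℝ) * I) ∂μ := fun n => by
        rw [charFun_apply_real, integral_map (hf n).aemeasurable (by fun_prop),
          ← integral_biUnion_finset K (fun k _ => hA k) hdisj fun k _ =>
            (integrable_exp_mul_I ((hf n).const_mul t) μ).integrableOn,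
          setIntegral_congr_set huniv, setIntegral_univ]
        simp
      simp only [ProbabilityMeasure.coe_mk, hν, hμ]
      exact tendsto_finsetSum _ fun k hk => h k hk t
  intro g
  have := (ProbabilityMeasure.tendsto_iff_forall_integral_tendsto.1 hlim) g
  simpa [integral_map (hf _).aemeasurable g.continuous.aestronglyMeasurable] using this
end

/-- for the elephant random walk remembering only the first `m` steps (the
first `m` steps forming a full-memory elephant random walk), with `qₖ = P(Sₘ = m-2k)`,
`rₖ = ((m-k)p + k(1-p))/m` and `pₖ = (m-2k)(2p-1)/m`: `Sₙ/n` converges in distribution to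
`Σₖ qₖ·δ_{pₖ}` and `(Sₙ - n(2p-1)Sₘ/m)/√n` converges in distribution to the mixture
`Σₖ qₖ·N(0, 4rₖ(1-rₖ))`. -/
theorem elephant_first_m_steps
    {Ω : Type*} [MeasurableSpace Ω] (μ : Measure Ω) [IsProbabilityMeasure μ]
    (p : ℝ) (hp0 : 0 < p) (hp1 : p < 1) (m : ℕ) (hm : 1 ≤ m)
    (X : ℕ → Ω → ℝ)
    (hXmeas : ∀ i, Measurable (X i))
    (hval : ∀ i, 1 ≤ i → ∀ᵐ ω ∂μ, X i ω = 1 ∨ X i ω = -1)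
    (hinit : μ {ω | X 1 ω = 1} = ENNReal.ofReal p)
    (hcondfull : ∀ k, 1 ≤ k → k < m →
      μ[X (k+1) | sigmaUpTo X k] =ᵐ[μ] fun ω => (2*p-1) * partialSum X k ω / k)
    (hcond : ∀ n, m ≤ n →
      μ[X (n+1) | sigmaUpTo X n] =ᵐ[μ] fun ω => (2*p-1) * partialSum X m ω / m) :
    TendstoInDistribution μ (fun n ω => partialSum X n ω / n)
      (∑ k ∈ Finset.range (m+1),
        (μ {ω | partialSum X m ω = (m : ℝ) - 2*k}) •
          Measure.dirac (((m : ℝ) - 2*k)*(2*p-1)/m)) ∧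
    TendstoInDistribution μ
      (fun n ω => (partialSum X n ω - n*(2*p-1)*partialSum X m ω/m) / Real.sqrt n)
      (∑ k ∈ Finset.range (m+1),
        (μ {ω | partialSum X m ω = (m : ℝ) - 2*k}) •
          gaussianReal 0 (Real.toNNReal
            (4*((((m : ℝ)-k)*p + k*(1-p))/m)*(1-(((m : ℝ)-k)*p + k*(1-p))/m)))) := by
  have hm0 : (m : ℝ) ≠ 0 := by positivity
  have hSm : ∀ n, Measurable (partialSum X n) := measurable_partialSum hXmeas
  have hA : ∀ k : ℕ, MeasurableSet {ω | partialSum X m ω = (m : ℝ) - 2 * k} := fun k =>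
    hSm m (measurableSet_singleton _)
  have hdisj : Set.Pairwise (Finset.range (m + 1) : Set ℕ)
      (Function.onFun Disjoint fun k : ℕ => {ω | partialSum X m ω = (m : ℝ) - 2 * k}) := by
    intro i _ j _ hij
    refine Set.disjoint_left.2 fun ω hi hj => hij ?_
    have : (i : ℝ) = j := by
      simp only [Set.mem_ofPred_eq] at hi hj
      linarith
    exact_mod_cast this
  have hcover := ae_exists_partialSum_eq hval m
  have hcharFun := fun k : ℕ => setIntegral_exp_partialSum (x := (m : ℝ) - 2 * k)
    (a := (m - 2 * k) * (2 * p - 1) / m) hXmeas hval (fun n hn => by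
      filter_upwards [hcond n hn] with ω hω hx
      rw [hω, hx]
      ring)
  constructor
  · refine tendstoInDistribution_sum_smul hA hdisj hcover (fun n => (hSm n).div_const _)
      fun k _ t => (tendsto_add_atTop_iff_nat m).1 ?_
    set a : ℝ := (m - 2 * k) * (2 * p - 1) / m with ha
    have hs := tendsto_div_natCast_add t m
    have hlim := tendsto_pow_exp_of_isLittleO (cos_add_sin_sub_isLittleO a) hs
      (v := t) (by simpa [mul_div_assoc'] using tendsto_natCast_mul_div_natCast_add t m)
    have hexp := tendsto_exp_mul_I_one hs ((m : ℝ) - 2 * k)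
    rw [charFun_dirac]
    convert (hexp.const_mul (μ.real {ω | partialSum X m ω = (m : ℝ) - 2 * k} : ℂ)).mul hlim
      using 2 with N
    · rw [← hcharFun]
      simp only [div_mul_eq_mul_div, mul_div_assoc']
    · simp only [RCLike.inner_apply, conj_trivial, mul_one]
      push_cast
      ring_nf
  · refine tendstoInDistribution_sum_smul hA hdisj hcover
      (fun n => by have := hSm n; have := hSm m; fun_prop)
      fun k hk t => (tendsto_add_atTop_iff_nat m).1 ?_
    have hkm : (k : ℝ) ≤ m := by exact_mod_cast Finset.mem_range_succ_iff.1 hk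
    set a : ℝ := (m - 2 * k) * (2 * p - 1) / m with ha
    set r : ℝ := (((m : ℝ) - k) * p + k * (1 - p)) / m with hr
    have har : a = 2 * r - 1 := by
      rw [ha, hr]
      field_simp
      ring
    have hr0 : 0 ≤ r := by
      have : 0 ≤ ((m : ℝ) - k) * p := mul_nonneg (by linarith) hp0.le
      have : 0 ≤ (k : ℝ) * (1 - p) := mul_nonneg (by positivity) (by linarith)
      positivity
    have hr1 : r ≤ 1 := by
      rw [hr, div_le_one (by positivity)]
      nlinarith [mul_nonneg (sub_nonneg.2 hkm) (sub_nonneg.2 hp1.le),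
        mul_nonneg k.cast_nonneg hp0.le]
    have hs : Tendsto (fun N : ℕ => t / √((N + m : ℕ) : ℝ)) atTop (𝓝 0) :=
      ((Real.tendsto_sqrt_atTop.comp tendsto_natCast_atTop_atTop).comp
        (tendsto_add_atTop_nat m)).const_div_atTop t
    have hlim := tendsto_pow_exp_of_isLittleO (exp_neg_mul_cos_add_sin_sub_isLittleO a) hs
      (v := t ^ 2) (by
        simpa [div_pow, Real.sq_sqrt, add_nonneg] using
          tendsto_natCast_mul_div_natCast_add (t ^ 2) m)
    have hexp := tendsto_exp_mul_I_one hs ((m : ℝ) - 2 * k - m * a)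
    rw [charFun_gaussianReal]
    convert (hexp.const_mul (μ.real {ω | partialSum X m ω = (m : ℝ) - 2 * k} : ℂ)).mul hlim
      using 2 with N
    · set s := t / √((N + m : ℕ) : ℝ) with hsdef
      have hcongr : ∀ ω ∈ {ω | partialSum X m ω = (m : ℝ) - 2 * k},
          Complex.exp ((t * ((partialSum X (N + m) ω - (N + m : ℕ) * (2 * p - 1) *
            partialSum X m ω / m) / √((N + m : ℕ) : ℝ)) : ℝ) * Complex.I) =
          Complex.exp ((-(s * (N + m : ℕ) * a) : ℝ) * Complex.I) *
            Complex.exp ((s * partialSum X (N + m) ω : ℝ) * Complex.I) := by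
        intro ω (hω : partialSum X m ω = _)
        rw [← Complex.exp_add, ← add_mul, ← Complex.ofReal_add, hω, ha, hsdef]
        congr 3
        ring
      rw [setIntegral_congr_fun (hA k) hcongr, integral_const_mul, hcharFun, mul_pow,
        ← Complex.exp_nat_mul]
      have hphase : Complex.exp ((-(s * (N + m : ℕ) * a) : ℝ) * Complex.I) *
          Complex.exp ((s * ((m : ℝ) - 2 * k) : ℝ) * Complex.I) =
          Complex.exp ((s * ((m : ℝ) - 2 * k - m * a) : ℝ) * Complex.I) *
            Complex.exp (N * (-(a * s * Complex.I))) := by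
        rw [← Complex.exp_add, ← Complex.exp_add]
        congr 1
        push_cast
        ring
      linear_combination ((μ.real {ω | partialSum X m ω = (m : ℝ) - 2 * k} : ℂ) *
        (Complex.cos s + a * Complex.sin s * Complex.I) ^ N) * hphase
    · have hv : 0 ≤ 4 * r * (1 - r) := by
        nlinarith [mul_nonneg hr0 (sub_nonneg.2 hr1)]
      rw [Real.coe_toNNReal _ hv, har, mul_one]
      congr 2
      push_cast
      ring
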